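/- (Key inequality in Lemma ImplicationLimites.) Let d ≥ 1, β > 0 and K : ℤ^d → ℝ symmetric with finite range R > 0 and K ≥ 0. Then for every integer L > R: ∫ σ₀ dν_{B_L}^{+} − ∫ σ₀ dν_{B_L}^{−} ≤ ∫ σ₀ dμ_{B_{L−R}}^{+} − ∫ σ₀ dμ_{B_{L−R}}^{−}, where σ₀ is the spin at the origin and superscript + (resp. −) denotes the constant boundary condition +1 (resp. −1). -/

import Mathlib

open MeasureTheory ProbabilityTheory

namespace ClassC

/-- Sites of the lattice `ℤ^d`. -/
abbrev Site (d : ℕ) := Fin d → ℤ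

/-- The spin space `{-1,+1} ⊂ ℝ`. -/
abbrev Spin : Type := ({-1, 1} : Finset ℝ)

/-- The spin `+1`. -/
def sPlus : Spin := ⟨1, by simp⟩
/-- The spin `-1`. -/
def sMinus : Spin := ⟨-1, by simp⟩

/-- Configuration space `{-1,+1}^{ℤ^d}`. -/
abbrev Config (d : ℕ) := Site d → Spin

variable {d : ℕ}

/-- The constant configuration `+1` (respectively `-1`). -/
def cPlus (d : ℕ) : Config d := fun _ => sPlus
def cMinus (d : ℕ) : Config d := fun _ => sMinus

/-- `K` is symmetric with finite range `R`: `K(k) = K(-k)` and `K(k) = 0` as soon as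
`Σᵢ |kᵢ| > R`. -/
def SymmFiniteRange (K : Site d → ℝ) (R : ℕ) : Prop :=
  (∀ k, K (-k) = K k) ∧ ∀ k : Site d, (R : ℤ) < ∑ i, |k i| → K k = 0

/-- The ball `B_L = {k : Σᵢ |kᵢ| ≤ L}` for the ℓ¹ norm on `ℤ^d`. -/
noncomputable def ball (d L : ℕ) : Finset (Site d) :=
  (Finset.Icc (fun _ => -(L : ℤ)) (fun _ => (L : ℤ))).filter fun k => ∑ i, |k i| ≤ (L : ℤ)

lemma zero_mem_ball (d L : ℕ) : (0 : Site d) ∈ ball d L := by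
  simp [ball, Finset.mem_filter, Finset.mem_Icc, Pi.le_def]

/-- `patch Λ σ τ` is the configuration `σ_Λ τ_{Λᶜ}`. -/
def patch (Λ : Finset (Site d)) (σ : ↥Λ → Spin) (τ : Config d) : Config d :=
  fun j => if h : j ∈ Λ then σ ⟨j, h⟩ else τ j

/-- The local mean field `β Σ_{k'} K(k'-k) η_{k'}` at site `k`. -/
noncomputable def field (β : ℝ) (K : Site d → ℝ) (k : Site d) (η : Config d) : ℝ :=
  β * ∑ᶠ k' : Site d, K (k' - k) * (η k' : ℝ)

/-- The class-C updating rule `p_k(s|η) = ½ (1 + s tanh(β Σ_{k'} K(k'-k) η_{k'}))`. -/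
noncomputable def upd (β : ℝ) (K : Site d → ℝ) (k : Site d) (η : Config d) (s : Spin) : ℝ :=
  (1 + (s : ℝ) * Real.tanh (field β K k η)) / 2

/-- Transition probabilities of the finite volume class-C dynamics `P_Λ^τ` on
`{-1,+1}^Λ`: `P_Λ^τ(σ|η) = Π_{k∈Λ} p_k(σ_k | η_Λ τ_{Λᶜ})`. -/
noncomputable def fvKer (β : ℝ) (K : Site d → ℝ) (Λ : Finset (Site d)) (τ : Config d)
    (η σ : ↥Λ → Spin) : ℝ :=
  ∏ k : ↥Λ, upd β K (k : Site d) (patch Λ η τ) (σ k)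

/-- The unnormalised weight of the finite volume reversible measure `ν_Λ^τ`:
`Π_{k∈Λ} cosh(β Σ_j K(k-j) σ̃_j) exp(β σ_k Σ_{j∈Λᶜ} K(k-j) τ_j)` with `σ̃ = σ_Λ τ_{Λᶜ}`. -/
noncomputable def nuWeight (β : ℝ) (K : Site d → ℝ) (Λ : Finset (Site d)) (τ : Config d)
    (σ : ↥Λ → Spin) : ℝ :=
  ∏ k : ↥Λ,
    Real.cosh (β * ∑ᶠ j : Site d, K ((k : Site d) - j) * ((patch Λ σ τ) j : ℝ)) *
      Real.exp (β * (σ k : ℝ) * ∑ᶠ j ∈ {j : Site d | j ∉ Λ}, K ((k : Site d) - j) * (τ j : ℝ))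

/-- The finite volume measure `ν_Λ^τ` (normalised weight). -/
noncomputable def nuFV (β : ℝ) (K : Site d → ℝ) (Λ : Finset (Site d)) (τ : Config d)
    (σ : ↥Λ → Spin) : ℝ :=
  nuWeight β K Λ τ σ / ∑ σ', nuWeight β K Λ τ σ'

/-- The finite volume Hamiltonian `Σ_{A ∩ Λ ≠ ∅} φ_A(σ_Λ τ_{Λᶜ})` for the potential `φ`
canonically associated to the dynamics: `φ_{U_k} = - log cosh(β Σ_j K(k-j) σ_j)` on
`U_k = {j : K(k-j) ≠ 0}` and `φ_A = 0` otherwise; the sum over `A` meeting `Λ` is the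
sum over those `k` with `U_k ∩ Λ ≠ ∅`. -/
noncomputable def ham (β : ℝ) (K : Site d → ℝ) (Λ : Finset (Site d)) (τ : Config d)
    (σ : ↥Λ → Spin) : ℝ :=
  ∑ᶠ (k : Site d) (_ : ∃ j ∈ Λ, K (k - j) ≠ 0),
    -Real.log (Real.cosh (β * ∑ᶠ j : Site d, K (k - j) * ((patch Λ σ τ) j : ℝ)))

/-- The finite volume Gibbs measure `μ_Λ^τ = exp(-H_Λ^τ)/Z_Λ^τ`. -/
noncomputable def gibbsFV (β : ℝ) (K : Site d → ℝ) (Λ : Finset (Site d)) (τ : Config d)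
    (σ : ↥Λ → Spin) : ℝ :=
  Real.exp (-ham β K Λ τ σ) / ∑ σ', Real.exp (-ham β K Λ τ σ')

/-- Mean value of the spin at the origin under a finite volume (probability) weight. -/
noncomputable def atZero {Λ : Finset (Site d)} (h : (0 : Site d) ∈ Λ)
    (ν : (↥Λ → Spin) → ℝ) : ℝ :=
  ∑ σ, ν σ * ((σ ⟨0, h⟩ : ℝ))

/-- The inner boundary `∂ᵢΔ = {k ∈ Δ : U_k ∩ Δᶜ ≠ ∅}`, `U_k = {j : K(k-j) ≠ 0}`. -/
def ibdry (K : Site d → ℝ) (Δ : Finset (Site d)) : Set (Site d) :=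
  {k | k ∈ Δ ∧ ∃ j ∉ Δ, K (k - j) ≠ 0}

end ClassC

namespace ClassC

lemma mem_ball_iff {d L : ℕ} (k : Site d) : k ∈ ball d L ↔ ∑ i, |k i| ≤ (L : ℤ) := by
  unfold ball
  simp only [Finset.mem_filter, Finset.mem_Icc, Pi.le_def, and_iff_right_iff_imp]
  intro h
  have h1 : ∀ i, |k i| ≤ (L : ℤ) := fun i =>
    (Finset.single_le_sum (f := fun i => |k i|) (fun j _ => abs_nonneg (k j))
      (Finset.mem_univ i)).trans h
  exact ⟨fun i => (abs_le.1 (h1 i)).1, fun i => (abs_le.1 (h1 i)).2⟩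

lemma norm_tri {d : ℕ} (a b : Site d) : ∑ i, |a i| ≤ ∑ i, |(a - b) i| + ∑ i, |b i| := by
  rw [← Finset.sum_add_distrib]
  refine Finset.sum_le_sum fun i _ => ?_
  have := abs_add_le (a i - b i) (b i)
  simpa using this

lemma supp_finite {d R : ℕ} {K : Site d → ℝ} (hK : SymmFiniteRange K R) (k : Site d)
    (f : Site d → ℝ) : (Function.support fun j => K (k - j) * f j).Finite := by
  have h : (Function.support K).Finite := by
    refine (ball d R).finite_toSet.subset fun x hx => ?_
    rw [Finset.mem_coe, mem_ball_iff]
    by_contra hc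
    exact hx (hK.2 x (not_le.1 hc))
  have h2 : ((fun j => k - j) ⁻¹' (Function.support K)).Finite :=
    h.preimage (fun a _ b _ hab => by simpa using hab)
  refine h2.subset fun j hj => ?_
  simp only [Function.mem_support, Set.mem_preimage] at hj ⊢
  exact left_ne_zero_of_mul hj

lemma finsum_mono_aux {α : Type*} {f g : α → ℝ} (hf : (Function.support f).Finite)
    (hg : (Function.support g).Finite) (h : ∀ a, f a ≤ g a) : ∑ᶠ a, f a ≤ ∑ᶠ a, g a := by
  have := finsum_nonneg (f := fun a => g a - f a) (fun a => sub_nonneg.2 (h a))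
  rw [finsum_sub_distrib hg hf] at this
  linarith

lemma cosh_aux {x y u v : ℝ} (hs : x + y = u + v) (hux : u ≤ x) (huy : u ≤ y) :
    Real.cosh x * Real.cosh y ≤ Real.cosh u * Real.cosh v := by
  have e1 := Real.cosh_add x y
  have e2 := Real.cosh_sub x y
  have e3 := Real.cosh_add u v
  have e4 := Real.cosh_sub u v
  have : Real.cosh (x - y) ≤ Real.cosh (u - v) := by
    rw [Real.cosh_le_cosh, abs_sub_comm u v, abs_of_nonneg (by linarith : 0 ≤ v - u), abs_le]
    constructor <;> linarith
  rw [hs] at e1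
  linarith

lemma patch_inf_sup {d : ℕ} (Λ : Finset (Site d)) (τ : Config d) (a b : ↥Λ → Spin) (j : Site d) :
    (patch Λ a τ j : ℝ) + (patch Λ b τ j : ℝ) =
      (patch Λ (a ⊓ b) τ j : ℝ) + (patch Λ (a ⊔ b) τ j : ℝ) := by
  unfold patch
  split_ifs with h
  · rcases le_total (a ⟨j, h⟩) (b ⟨j, h⟩) with hab | hab
    · simp [Pi.inf_apply, Pi.sup_apply, inf_eq_left.2 hab, sup_eq_right.2 hab]
    · simp [Pi.inf_apply, Pi.sup_apply, inf_eq_right.2 hab, sup_eq_left.2 hab, add_comm]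
  · rfl

lemma patch_mono {d : ℕ} (Λ : Finset (Site d)) (τ : Config d) {a b : ↥Λ → Spin} (hab : a ≤ b)
    (j : Site d) : (patch Λ a τ j : ℝ) ≤ (patch Λ b τ j : ℝ) := by
  unfold patch
  split_ifs with h
  · exact hab ⟨j, h⟩
  · exact le_rfl

lemma nuWeight_pos {d : ℕ} (β : ℝ) (K : Site d → ℝ) (Λ : Finset (Site d)) (τ : Config d)
    (σ : ↥Λ → Spin) : 0 < nuWeight β K Λ τ σ :=
  Finset.prod_pos fun _ _ => mul_pos (Real.cosh_pos _) (Real.exp_pos _)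

lemma nuWeight_super {d R : ℕ} {β : ℝ} (hβ : 0 < β) {K : Site d → ℝ} (hK : SymmFiniteRange K R)
    (hKpos : ∀ k, 0 ≤ K k) (Λ : Finset (Site d)) (τ : Config d) (a b : ↥Λ → Spin) :
    nuWeight β K Λ τ a * nuWeight β K Λ τ b ≤
      nuWeight β K Λ τ (a ⊓ b) * nuWeight β K Λ τ (a ⊔ b) := by
  unfold nuWeight
  rw [← Finset.prod_mul_distrib, ← Finset.prod_mul_distrib]
  refine Finset.prod_le_prod (fun k _ => by positivity) fun k _ => ?_
  rw [mul_mul_mul_comm]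
  conv_rhs => rw [mul_mul_mul_comm]
  have hmono : ∀ {x y : ↥Λ → Spin}, x ≤ y →
      β * ∑ᶠ j : Site d, K ((k : Site d) - j) * ((patch Λ x τ) j : ℝ) ≤
      β * ∑ᶠ j : Site d, K ((k : Site d) - j) * ((patch Λ y τ) j : ℝ) := fun {x y} hxy =>
    mul_le_mul_of_nonneg_left (finsum_mono_aux (supp_finite hK _ _) (supp_finite hK _ _)
      (fun j => mul_le_mul_of_nonneg_left (patch_mono Λ τ hxy j) (hKpos _))) hβ.le
  refine mul_le_mul (cosh_aux ?_ (hmono inf_le_left) (hmono inf_le_right)) (le_of_eq ?_)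
    (by positivity) (by positivity)
  · rw [← mul_add, ← mul_add, ← finsum_add_distrib (supp_finite hK _ _) (supp_finite hK _ _),
      ← finsum_add_distrib (supp_finite hK _ _) (supp_finite hK _ _)]
    congr 1
    refine finsum_congr fun j => ?_
    rw [← mul_add, ← mul_add, patch_inf_sup]
  · rw [← Real.exp_add, ← Real.exp_add, ← add_mul, ← add_mul, ← mul_add, ← mul_add]
    have := patch_inf_sup Λ τ a b k
    simp only [patch, k.2, dif_pos] at this
    rw [this]

/-- Extension of a configuration on a subset to the whole of the region by `τ`. -/
def ext (Λ Λ' : Finset (Site d)) (τ : Config d) (σ : ↥Λ' → Spin) : ↥Λ → Spin :=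
  fun j => patch Λ' σ τ j

lemma patch_ext {d : ℕ} {Λ Λ' : Finset (Site d)} (h : Λ' ⊆ Λ) (τ : Config d) (σ : ↥Λ' → Spin) :
    patch Λ (ext Λ Λ' τ σ) τ = patch Λ' σ τ := by
  funext j
  by_cases hj : j ∈ Λ
  · simp [patch, ext, hj]
  · have : j ∉ Λ' := fun h' => hj (h h')
    simp [patch, hj, this]

lemma ext_inj {d : ℕ} {Λ Λ' : Finset (Site d)} (h : Λ' ⊆ Λ) (τ : Config d) :
    Function.Injective (ext Λ Λ' τ) := by
  intro a b hab
  funext j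
  have := congrFun hab ⟨j, h j.2⟩
  simpa [ext, patch] using this

lemma mem_range_ext {d : ℕ} {Λ Λ' : Finset (Site d)} (h : Λ' ⊆ Λ) (τ : Config d)
    (η : ↥Λ → Spin) :
    η ∈ Set.range (ext Λ Λ' τ) ↔ ∀ j : ↥Λ, (j : Site d) ∉ Λ' → η j = τ j := by
  constructor
  · rintro ⟨σ, rfl⟩ j hj
    simp [ext, patch, hj]
  · intro H
    refine ⟨fun j => η ⟨j, h j.2⟩, ?_⟩
    funext j
    by_cases hj : (j : Site d) ∈ Λ'
    · simp [ext, patch, hj]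
    · simp [ext, patch, hj, H j hj]

open Classical in
lemma sum_range_ext {d : ℕ} {Λ Λ' : Finset (Site d)} (h : Λ' ⊆ Λ) (τ : Config d)
    (F : (↥Λ → Spin) → ℝ) :
    ∑ η, (if η ∈ Set.range (ext Λ Λ' τ) then F η else 0) = ∑ σ, F (ext Λ Λ' τ σ) := by
  rw [← Finset.sum_filter]
  symm
  refine Finset.sum_bij (fun σ _ => ext Λ Λ' τ σ) (by simp) (fun a _ b _ hab => ext_inj h τ hab)
    ?_ (by simp)
  intro b hb
  simpa using hb

open Classical in
lemma exp_ham {d : ℕ} (β : ℝ) (K : Site d → ℝ) {Λ Λ' : Finset (Site d)}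
    (hS : ∀ k, (∃ j ∈ Λ', K (k - j) ≠ 0) → k ∈ Λ) (τ : Config d) (σ : ↥Λ' → Spin) :
    Real.exp (-ham β K Λ' τ σ) = ∏ k : ↥Λ, if (∃ j ∈ Λ', K ((k : Site d) - j) ≠ 0) then
      Real.cosh (β * ∑ᶠ j : Site d, K ((k : Site d) - j) * ((patch Λ' σ τ) j : ℝ)) else 1 := by
  unfold ham
  rw [finsum_eq_sum_of_support_subset (s := Λ), ← Finset.sum_coe_sort, ← Finset.sum_neg_distrib,
    Real.exp_sum]
  · refine Finset.prod_congr rfl fun k _ => ?_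
    rw [finsum_eq_if]
    split_ifs
    · rw [neg_neg, Real.exp_log (Real.cosh_pos _)]
    · simp
  · intro k hk
    rw [Function.mem_support, finsum_eq_if] at hk
    by_contra hc
    exact hk (if_neg fun h => hc (hS k h))

lemma nuWeight_ext {d : ℕ} (β : ℝ) (K : Site d → ℝ) {Λ Λ' : Finset (Site d)} (hsub : Λ' ⊆ Λ)
    (hS : ∀ k, (∃ j ∈ Λ', K (k - j) ≠ 0) → k ∈ Λ)
    (hS' : ∀ k ∈ Λ', ∀ j, j ∉ Λ → K (k - j) = 0) (τ : Config d) :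
    ∃ C : ℝ, 0 < C ∧ ∀ σ : ↥Λ' → Spin,
      nuWeight β K Λ τ (ext Λ Λ' τ σ) = C * Real.exp (-ham β K Λ' τ σ) := by
  classical
  refine ⟨∏ k : ↥Λ, (if (∃ j ∈ Λ', K ((k : Site d) - j) ≠ 0) then 1 else
      Real.cosh (β * ∑ᶠ j : Site d, K ((k : Site d) - j) * (τ j : ℝ))) *
      Real.exp (β * (τ k : ℝ) * ∑ᶠ j ∈ {j : Site d | j ∉ Λ}, K ((k : Site d) - j) * (τ j : ℝ)),
      Finset.prod_pos fun k _ => mul_pos ?_ (Real.exp_pos _), fun σ => ?_⟩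
  · split_ifs
    · exact one_pos
    · exact Real.cosh_pos _
  rw [exp_ham β K hS, ← Finset.prod_mul_distrib]
  unfold nuWeight
  rw [patch_ext hsub]
  refine Finset.prod_congr rfl fun k _ => ?_
  have hexp : β * ((ext Λ Λ' τ σ k : Spin) : ℝ) *
        ∑ᶠ j ∈ {j : Site d | j ∉ Λ}, K ((k : Site d) - j) * (τ j : ℝ) =
      β * (τ k : ℝ) * ∑ᶠ j ∈ {j : Site d | j ∉ Λ}, K ((k : Site d) - j) * (τ j : ℝ) := by
    by_cases hk : (k : Site d) ∈ Λ'
    · have : ∑ᶠ j ∈ {j : Site d | j ∉ Λ}, K ((k : Site d) - j) * (τ j : ℝ) = 0 := by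
        refine finsum_mem_eq_zero_of_forall_eq_zero fun j hj => ?_
        rw [hS' k hk j hj, zero_mul]
      rw [this, mul_zero, mul_zero]
    · simp [ext, patch, hk]
  rw [hexp]
  split_ifs with hk
  · ring
  · have : ∑ᶠ j : Site d, K ((k : Site d) - j) * ((patch Λ' σ τ) j : ℝ) =
        ∑ᶠ j : Site d, K ((k : Site d) - j) * (τ j : ℝ) := by
      refine finsum_congr fun j => ?_
      by_cases hj : j ∈ Λ'
      · have : K ((k : Site d) - j) = 0 := by
          by_contra hc
          exact hk ⟨j, hj, hc⟩
        rw [this, zero_mul, zero_mul]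
      · simp [patch, hj]
    rw [this]
    ring

/-- Holley comparison for unnormalised weights. -/
lemma holley_spin {d : ℕ} {Λ : Finset (Site d)} (o : ↥Λ) (f g : (↥Λ → Spin) → ℝ)
    (hf : ∀ a, 0 ≤ f a) (hg : ∀ a, 0 ≤ g a) (hf0 : 0 < ∑ a, f a) (hg0 : 0 < ∑ a, g a)
    (h : ∀ a b, f a * g b ≤ f (a ⊓ b) * g (a ⊔ b)) :
    (∑ a, f a * (a o : ℝ)) / ∑ a, f a ≤ (∑ a, g a * (a o : ℝ)) / ∑ a, g a := by
  classical
  have key := holley (fun a => f a / ∑ a, f a) (fun a => g a / ∑ a, g a)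
    (fun a : ↥Λ → Spin => (a o : ℝ) + 1)
    (fun a => by
      have := (a o).2
      simp only [Finset.mem_insert, Finset.mem_singleton] at this
      rcases this with h | h <;> simp [h])
    (fun a => div_nonneg (hf a) hf0.le) (fun a => div_nonneg (hg a) hg0.le)
    (fun a b hab => by
      have : (a o : ℝ) ≤ (b o : ℝ) := hab o
      simpa using this)
    (by rw [← Finset.sum_div, ← Finset.sum_div, div_self hf0.ne', div_self hg0.ne'])
    (fun a b => by
      rw [div_mul_div_comm, div_mul_div_comm]
      exact div_le_div_of_nonneg_right (h a b) (mul_pos hf0 hg0).le)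
  have e : ∀ f : (↥Λ → Spin) → ℝ, 0 < ∑ a, f a →
      ∑ a, ((a o : ℝ) + 1) * (f a / ∑ a, f a) = (∑ a, f a * (a o : ℝ)) / (∑ a, f a) + 1 := by
    intro f hf
    have h1 : ∀ a : ↥Λ → Spin, ((a o : ℝ) + 1) * (f a / ∑ a, f a) =
        (f a * (a o : ℝ)) / (∑ a, f a) + f a / ∑ a, f a := fun a => by ring
    rw [Finset.sum_congr rfl fun a _ => h1 a, Finset.sum_add_distrib, ← Finset.sum_div,
      ← Finset.sum_div, div_self hf.ne']
  rw [e f hf0, e g hg0] at key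
  linarith

lemma atZero_nu {d : ℕ} (β : ℝ) (K : Site d → ℝ) {Λ : Finset (Site d)} (h : (0 : Site d) ∈ Λ)
    (τ : Config d) : atZero h (nuFV β K Λ τ) =
      (∑ a, nuWeight β K Λ τ a * (a ⟨0, h⟩ : ℝ)) / ∑ a, nuWeight β K Λ τ a := by
  unfold atZero nuFV
  rw [Finset.sum_div]
  exact Finset.sum_congr rfl fun a _ => by ring

open Classical in
lemma atZero_gibbs {d : ℕ} (β : ℝ) (K : Site d → ℝ) {Λ Λ' : Finset (Site d)} (hsub : Λ' ⊆ Λ)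
    (hS : ∀ k, (∃ j ∈ Λ', K (k - j) ≠ 0) → k ∈ Λ)
    (hS' : ∀ k ∈ Λ', ∀ j, j ∉ Λ → K (k - j) = 0) (h : (0 : Site d) ∈ Λ')
    (τ : Config d) : atZero h (gibbsFV β K Λ' τ) =
      (∑ a, (if a ∈ Set.range (ext Λ Λ' τ) then nuWeight β K Λ τ a else 0) *
        (a ⟨0, hsub h⟩ : ℝ)) /
      ∑ a, (if a ∈ Set.range (ext Λ Λ' τ) then nuWeight β K Λ τ a else 0) := by
  obtain ⟨C, hC, hw⟩ := nuWeight_ext β K hsub hS hS' τ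
  simp only [ite_mul, zero_mul]
  rw [sum_range_ext hsub τ (nuWeight β K Λ τ), sum_range_ext hsub τ
    (fun a => nuWeight β K Λ τ a * (a ⟨0, hsub h⟩ : ℝ))]
  simp only [hw, mul_assoc]
  rw [← Finset.mul_sum, ← Finset.mul_sum, mul_div_mul_left _ _ hC.ne']
  unfold atZero gibbsFV
  rw [Finset.sum_div]
  refine Finset.sum_congr rfl fun a _ => ?_
  simp only [ext, patch, h, dif_pos]
  ring

lemma sum_ind_pos {d : ℕ} (β : ℝ) (K : Site d → ℝ) {Λ Λ' : Finset (Site d)} (hsub : Λ' ⊆ Λ)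
    (τ : Config d) [DecidablePred (· ∈ Set.range (ext Λ Λ' τ))] :
    0 < ∑ a, (if a ∈ Set.range (ext Λ Λ' τ) then nuWeight β K Λ τ a else 0) := by
  have : Nonempty (↥Λ' → Spin) := ⟨fun _ => sPlus⟩
  have := sum_range_ext hsub τ (nuWeight β K Λ τ)
  have h2 : 0 < ∑ σ, nuWeight β K Λ τ (ext Λ Λ' τ σ) :=
    Finset.sum_pos (fun σ _ => nuWeight_pos β K Λ τ (ext Λ Λ' τ σ)) Finset.univ_nonempty
  rw [← this] at h2
  convert h2

lemma sum_nu_pos {d : ℕ} (β : ℝ) (K : Site d → ℝ) {Λ : Finset (Site d)} (τ : Config d) :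
    0 < ∑ a, nuWeight β K Λ τ a := by
  have : Nonempty (↥Λ → Spin) := ⟨fun _ => sPlus⟩
  exact Finset.sum_pos (fun σ _ => nuWeight_pos β K Λ τ σ) Finset.univ_nonempty

lemma le_sPlus (s : Spin) : s ≤ sPlus := by
  have h := s.2
  simp only [Finset.mem_insert, Finset.mem_singleton] at h
  change (s : ℝ) ≤ 1
  rcases h with h | h <;> rw [h] <;> norm_num

lemma sMinus_le (s : Spin) : sMinus ≤ s := by
  have h := s.2
  simp only [Finset.mem_insert, Finset.mem_singleton] at h
  change -1 ≤ (s : ℝ)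
  rcases h with h | h <;> rw [h]; norm_num

end ClassC

open ClassC in
/-- key inequality in Lemma `ImplicationLimites`: for `L > R`,
`∫σ₀ dν_{B_L}^{+} − ∫σ₀ dν_{B_L}^{−} ≤ ∫σ₀ dμ_{B_{L−R}}^{+} − ∫σ₀ dμ_{B_{L−R}}^{−}`. -/
theorem stmt_14
    (d : ℕ) (hd : 1 ≤ d) (β : ℝ) (hβ : 0 < β)
    (K : Site d → ℝ) (R : ℕ) (hR : 1 ≤ R) (hK : SymmFiniteRange K R)
    (hKpos : ∀ k, 0 ≤ K k)
    (L : ℕ) (hL : R < L) :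
    atZero (zero_mem_ball d L) (nuFV β K (ball d L) (cPlus d)) -
        atZero (zero_mem_ball d L) (nuFV β K (ball d L) (cMinus d)) ≤
      atZero (zero_mem_ball d (L - R)) (gibbsFV β K (ball d (L - R)) (cPlus d)) -
        atZero (zero_mem_ball d (L - R)) (gibbsFV β K (ball d (L - R)) (cMinus d)) := by
  classical
  have hsub : ball d (L - R) ⊆ ball d L := by
    intro k hk
    rw [mem_ball_iff] at hk ⊢
    refine hk.trans ?_
    exact_mod_cast Nat.sub_le L R
  have hcast : ((L - R : ℕ) : ℤ) = L - R := by
    rw [Nat.cast_sub hL.le]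
  have hS : ∀ k, (∃ j ∈ ball d (L - R), K (k - j) ≠ 0) → k ∈ ball d L := by
    rintro k ⟨j, hj, hkj⟩
    rw [mem_ball_iff] at hj ⊢
    have h1 : ∑ i, |(k - j) i| ≤ (R : ℤ) := by
      by_contra hc
      exact hkj (hK.2 _ (not_le.1 hc))
    have h2 := norm_tri k j
    linarith
  have hS' : ∀ k ∈ ball d (L - R), ∀ j, j ∉ ball d L → K (k - j) = 0 := by
    intro k hk j hj
    by_contra hc
    refine hj (hS j ⟨k, hk, ?_⟩)
    rw [← neg_sub, hK.1]
    exact hc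
  have h0 := zero_mem_ball d (L - R)
  have hp : atZero (zero_mem_ball d L) (nuFV β K (ball d L) (cPlus d)) ≤
      atZero h0 (gibbsFV β K (ball d (L - R)) (cPlus d)) := by
    rw [atZero_nu, atZero_gibbs β K hsub hS hS']
    refine holley_spin _ _ _ (fun a => (nuWeight_pos _ _ _ _ _).le) (fun a => ?_)
      (sum_nu_pos _ _ _) (sum_ind_pos β K hsub _) (fun a b => ?_)
    · split_ifs
      · exact (nuWeight_pos _ _ _ _ _).le
      · exact le_rfl
    · by_cases hb : b ∈ Set.range (ext (ball d L) (ball d (L - R)) (cPlus d))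
      · have hab : a ⊔ b ∈ Set.range (ext (ball d L) (ball d (L - R)) (cPlus d)) := by
          rw [mem_range_ext hsub] at hb ⊢
          intro j hj
          rw [Pi.sup_apply, hb j hj]
          exact sup_eq_right.2 (le_sPlus _)
        rw [if_pos hb, if_pos hab]
        exact nuWeight_super hβ hK hKpos _ _ _ _
      · rw [if_neg hb, mul_zero]
        refine mul_nonneg (nuWeight_pos _ _ _ _ _).le ?_
        split_ifs
        · exact (nuWeight_pos _ _ _ _ _).le
        · exact le_rfl
  have hm : atZero h0 (gibbsFV β K (ball d (L - R)) (cMinus d)) ≤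
      atZero (zero_mem_ball d L) (nuFV β K (ball d L) (cMinus d)) := by
    rw [atZero_nu, atZero_gibbs β K hsub hS hS']
    refine holley_spin _ _ _ (fun a => ?_) (fun a => (nuWeight_pos _ _ _ _ _).le)
      (sum_ind_pos β K hsub _) (sum_nu_pos _ _ _) (fun a b => ?_)
    · split_ifs
      · exact (nuWeight_pos _ _ _ _ _).le
      · exact le_rfl
    · by_cases ha : a ∈ Set.range (ext (ball d L) (ball d (L - R)) (cMinus d))
      · have hab : a ⊓ b ∈ Set.range (ext (ball d L) (ball d (L - R)) (cMinus d)) := by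
          rw [mem_range_ext hsub] at ha ⊢
          intro j hj
          rw [Pi.inf_apply, ha j hj]
          exact inf_eq_left.2 (sMinus_le _)
        rw [if_pos ha, if_pos hab]
        exact nuWeight_super hβ hK hKpos _ _ _ _
      · rw [if_neg ha, zero_mul]
        refine mul_nonneg ?_ (nuWeight_pos _ _ _ _ _).le
        split_ifs
        · exact (nuWeight_pos _ _ _ _ _).le
        · exact le_rfl
  linarith
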